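/- Stability of representations under the diamond norm (Theorem thm:stability). Let G be a finite group and φ: G → superoperators on M_d a map with each φ(g) a quantum channel (so ‖φ(g)‖_⋄ = 1), satisfying (1/|G|) Σ_{g∈G} ‖Id − φ(g)∘φ(g⁻¹)‖_⋄ ≤ δ. Let ω and ω' be finite-dimensional complex representations of G on spaces V and V', and let L: ℂ^{d²} → V, R: V → ℂ^{d²}, L': ℂ^{d²} → V', R': V' → ℂ^{d²} be linear maps such that (1/|G|) Σ_{g∈G} ‖φ(g) − R∘ω(g)∘L‖_⋄ ≤ ε and (1/|G|) Σ_{g∈G} ‖φ(g) − R'∘ω'(g)∘L'‖_⋄ ≤ ε'. Assume there exists K with ‖R∘ω(g)∘L‖_⋄ ≤ K and ‖R'∘ω'(g)∘L'‖_⋄ ≤ K for all g ∈ G. If K(ε + ε') + 3δ + 2ε + ε² < 1, then there exists a linear map T: V' → V of rank at least d² that intertwines the representations, i.e. ω(g)∘T = T∘ω'(g) for all g ∈ G; in particular ω and ω' are equivalent on a subspace of dimension at least d². -/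

import Mathlib

open scoped Matrix Kronecker BigOperators

namespace RB

/-- The trace norm (sum of singular values) of a complex matrix. -/
noncomputable def traceNorm {m n : Type} [Fintype m] [Fintype n] [DecidableEq m]
    (A : Matrix m n ℂ) : ℝ :=
  ∑ i : m, Real.sqrt ((Matrix.isHermitian_mul_conjTranspose_self A).eigenvalues i)

/-- Application of a superoperator (given as a `d² × d²` matrix in the matrix-unit basis)
to a `d × d` matrix. -/
noncomputable def app {d : ℕ} (Φ : Matrix (Fin d × Fin d) (Fin d × Fin d) ℂ)
    (ρ : Matrix (Fin d) (Fin d) ℂ) : Matrix (Fin d) (Fin d) ℂ :=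
  Matrix.of fun i j => ∑ p : Fin d × Fin d, Φ (i, j) p * ρ p.1 p.2

/-- The action of `Φ ⊗ id` on `M_d ⊗ M_d ≅ M_{d²}`, where elements of `M_d ⊗ M_d` are
matrices indexed by pairs. -/
noncomputable def tensorIdApp {d : ℕ} (Φ : Matrix (Fin d × Fin d) (Fin d × Fin d) ℂ)
    (X : Matrix (Fin d × Fin d) (Fin d × Fin d) ℂ) : Matrix (Fin d × Fin d) (Fin d × Fin d) ℂ :=
  Matrix.of fun p q => ∑ r : Fin d × Fin d, Φ (p.1, q.1) r * X (r.1, p.2) (r.2, q.2)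

/-- The diamond norm of a superoperator on `M_d`. -/
noncomputable def diamondNorm {d : ℕ} (Φ : Matrix (Fin d × Fin d) (Fin d × Fin d) ℂ) : ℝ :=
  ⨆ X : {X : Matrix (Fin d × Fin d) (Fin d × Fin d) ℂ // X ≠ 0},
    traceNorm (tensorIdApp Φ X.1) / traceNorm X.1

/-- The Choi matrix of a superoperator. -/
def choi {d : ℕ} (Φ : Matrix (Fin d × Fin d) (Fin d × Fin d) ℂ) :
    Matrix (Fin d × Fin d) (Fin d × Fin d) ℂ :=
  Matrix.of fun p q => Φ (p.2, q.2) (p.1, q.1)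

open scoped ComplexOrder

/-- A superoperator is completely positive iff its Choi matrix is positive semidefinite. -/
def IsCompletelyPositive {d : ℕ} (Φ : Matrix (Fin d × Fin d) (Fin d × Fin d) ℂ) : Prop :=
  (choi Φ).PosSemidef

/-- Trace non-increasing superoperator. -/
def IsTraceNonIncreasing {d : ℕ} (Φ : Matrix (Fin d × Fin d) (Fin d × Fin d) ℂ) : Prop :=
  ∀ ρ : Matrix (Fin d) (Fin d) ℂ, ρ.PosSemidef → ((app Φ ρ).trace).re ≤ (ρ.trace).re

/-- Trace preserving superoperator. -/
def IsTracePreserving {d : ℕ} (Φ : Matrix (Fin d × Fin d) (Fin d × Fin d) ℂ) : Prop :=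
  ∀ ρ : Matrix (Fin d) (Fin d) ℂ, (app Φ ρ).trace = ρ.trace

/-- A quantum channel: completely positive and trace preserving. -/
def IsChannel {d : ℕ} (Φ : Matrix (Fin d × Fin d) (Fin d × Fin d) ℂ) : Prop :=
  IsCompletelyPositive Φ ∧ IsTracePreserving Φ

/-- A quantum state: positive semidefinite with unit trace. -/
def IsState {d : ℕ} (ρ : Matrix (Fin d) (Fin d) ℂ) : Prop :=
  ρ.PosSemidef ∧ ρ.trace = 1

/-- A POVM: a family of positive semidefinite matrices summing to the identity. -/
def IsPOVM {d : ℕ} {I : Type} [Fintype I] (P : I → Matrix (Fin d) (Fin d) ℂ) : Prop :=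
  (∀ i, (P i).PosSemidef) ∧ ∑ i, P i = 1


end RB

namespace RB

section TraceNorm

open Matrix

variable {n : Type} [Fintype n] [DecidableEq n]

local notation "clm" => Matrix.toEuclideanCLM (n := n) (𝕜 := ℂ)

lemma inner_toEuclideanCLM_conjTranspose (A : Matrix n n ℂ) (x y : EuclideanSpace ℂ n) :
    inner ℂ (clm Aᴴ x) y = inner ℂ x (clm A y) := by
  rw [← Matrix.star_eq_conjTranspose, map_star, ContinuousLinearMap.star_eq_adjoint,
    ContinuousLinearMap.adjoint_inner_left]

lemma trace_eq_sum_inner_toEuclideanCLM {ι : Type} [Fintype ι] (A : Matrix n n ℂ)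
    (b : OrthonormalBasis ι ℂ (EuclideanSpace ℂ n)) :
    A.trace = ∑ i, inner ℂ (b i) (clm A (b i)) := by
  have h1 := (LinearMap.trace_eq_sum_inner
    (clm A : EuclideanSpace ℂ n →ₗ[ℂ] EuclideanSpace ℂ n) b).symm.trans
      (LinearMap.trace_eq_sum_inner _ (EuclideanSpace.basisFun n ℂ))
  simp only [ContinuousLinearMap.coe_coe] at h1
  rw [h1]
  simp [Matrix.trace, EuclideanSpace.inner_single_left]

lemma trace_mul_eq_sum_inner {ι : Type} [Fintype ι] (A U : Matrix n n ℂ)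
    (b : OrthonormalBasis ι ℂ (EuclideanSpace ℂ n)) :
    (A * U).trace = ∑ i, inner ℂ (clm Aᴴ (b i)) (clm U (b i)) := by
  rw [trace_eq_sum_inner_toEuclideanCLM _ b]
  simp_rw [inner_toEuclideanCLM_conjTranspose]
  simp [map_mul]

/-- The images under `Aᴴ` of the eigenvectors of `A * Aᴴ` are orthogonal. -/
lemma inner_conjTranspose_eigenvectorBasis (A : Matrix n n ℂ) (i j : n) :
    inner ℂ (clm Aᴴ ((isHermitian_mul_conjTranspose_self A).eigenvectorBasis i))
        (clm Aᴴ ((isHermitian_mul_conjTranspose_self A).eigenvectorBasis j)) =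
      if i = j then ((isHermitian_mul_conjTranspose_self A).eigenvalues i : ℂ) else 0 := by
  set hA := isHermitian_mul_conjTranspose_self A
  rw [inner_toEuclideanCLM_conjTranspose]
  have h : clm A (clm Aᴴ (hA.eigenvectorBasis j)) =
      (hA.eigenvalues j : ℂ) • hA.eigenvectorBasis j := by
    rw [← mul_apply_eq_comp, ← map_mul]
    ext k
    have := congrFun (hA.mulVec_eigenvectorBasis j) k
    simpa using this
  rw [h, inner_smul_right, orthonormal_iff_ite.mp hA.eigenvectorBasis.orthonormal i j]
  split_ifs with hij
  · simp [hij]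
  · simp

lemma norm_conjTranspose_eigenvectorBasis (A : Matrix n n ℂ) (i : n) :
    ‖clm Aᴴ ((isHermitian_mul_conjTranspose_self A).eigenvectorBasis i)‖ =
      √((isHermitian_mul_conjTranspose_self A).eigenvalues i) := by
  have h := inner_conjTranspose_eigenvectorBasis A i i
  rw [inner_self_eq_norm_sq_to_K, if_pos rfl] at h
  have h' : ‖clm Aᴴ ((isHermitian_mul_conjTranspose_self A).eigenvectorBasis i)‖ ^ 2 =
      (isHermitian_mul_conjTranspose_self A).eigenvalues i :=
    Complex.ofReal_injective (by push_cast; exact h)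
  rw [← h', Real.sqrt_sq (norm_nonneg _)]

lemma norm_trace_mul_le_traceNorm (A : Matrix n n ℂ) {U : Matrix n n ℂ} (hU : ‖clm U‖ ≤ 1) :
    ‖(A * U).trace‖ ≤ traceNorm A := by
  set e := (isHermitian_mul_conjTranspose_self A).eigenvectorBasis with he
  rw [trace_mul_eq_sum_inner A U e]
  refine norm_sum_le_of_le _ fun i _ => ?_
  rw [← norm_conjTranspose_eigenvectorBasis]
  refine (norm_inner_le_norm _ _).trans (mul_le_of_le_one_right (norm_nonneg _) ?_)
  simpa using (clm U).le_of_opNorm_le hU (e i)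

lemma exists_trace_mul_eq_traceNorm (A : Matrix n n ℂ) :
    ∃ U : Matrix n n ℂ, ‖clm U‖ ≤ 1 ∧ (A * U).trace = traceNorm A := by
  set e := (isHermitian_mul_conjTranspose_self A).eigenvectorBasis with he
  set s : n → ℝ := fun i => ‖clm Aᴴ (e i)‖ with hs
  have horth (i j : n) (hij : i ≠ j) : inner ℂ (clm Aᴴ (e i)) (clm Aᴴ (e j)) = 0 := by
    rw [inner_conjTranspose_eigenvectorBasis, if_neg hij]
  set w : n → EuclideanSpace ℂ n := fun i => ((s i)⁻¹ : ℂ) • clm Aᴴ (e i) with hw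
  have hw1 (i : n) : ‖w i‖ ≤ 1 := by
    simp only [hw, norm_smul, norm_inv, Complex.norm_real, hs, norm_norm]
    exact inv_mul_le_one
  set W : EuclideanSpace ℂ n →L[ℂ] EuclideanSpace ℂ n :=
    ∑ i, (innerSL ℂ (e i)).smulRight (w i) with hW
  have hWe (x : EuclideanSpace ℂ n) : W x = ∑ i, inner ℂ (e i) x • w i := by
    simp [hW]
  refine ⟨(clm).symm W, ?_, ?_⟩
  · have hsymm : clm ((clm).symm W) = W := (clm).apply_symm_apply W
    rw [hsymm]
    refine W.opNorm_le_bound zero_le_one fun x => ?_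
    rw [one_mul, ← sq_le_sq₀ (norm_nonneg _) (norm_nonneg _), ← e.sum_sq_norm_inner_right x]
    have h1 : (inner ℂ (W x) (W x) : ℂ) = ∑ i, ((‖inner ℂ (e i) x‖ ^ 2 * ‖w i‖ ^ 2 : ℝ) : ℂ) := by
      rw [hWe, sum_inner]
      refine Finset.sum_congr rfl fun i _ => ?_
      rw [inner_sum, Finset.sum_eq_single i]
      · rw [inner_smul_left, inner_smul_right, inner_self_eq_norm_sq_to_K, ← mul_assoc,
          RCLike.conj_mul]
        push_cast
        rfl
      · intro j _ hj
        simp [hw, inner_smul_left, inner_smul_right, horth i j hj.symm]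
      · simp
    rw [inner_self_eq_norm_sq_to_K] at h1
    have h2 : ‖W x‖ ^ 2 = ∑ i, (‖inner ℂ (e i) x‖ ^ 2 * ‖w i‖ ^ 2) :=
      Complex.ofReal_injective (by push_cast at h1 ⊢; exact h1)
    rw [h2]
    gcongr with i
    exact mul_le_of_le_one_right (by positivity) (pow_le_one₀ (norm_nonneg _) (hw1 i))
  · have hsymm : clm ((clm).symm W) = W := (clm).apply_symm_apply W
    rw [trace_mul_eq_sum_inner A _ e, hsymm, traceNorm]
    push_cast
    refine Finset.sum_congr rfl fun i _ => ?_
    rw [← norm_conjTranspose_eigenvectorBasis, hWe, Finset.sum_eq_single i]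
    · rw [orthonormal_iff_ite.mp e.orthonormal, if_pos rfl, one_smul]
      simp only [hw, inner_smul_right, inner_self_eq_norm_sq_to_K]
      change ((s i : ℂ))⁻¹ * (s i : ℂ) ^ 2 = (s i : ℂ)
      by_cases h : (s i : ℂ) = 0
      · simp [h]
      · field_simp
    · intro j _ hj
      rw [orthonormal_iff_ite.mp e.orthonormal, if_neg hj, zero_smul]
    · simp

lemma traceNorm_le_of_forall {A : Matrix n n ℂ} {c : ℝ}
    (h : ∀ U : Matrix n n ℂ, ‖clm U‖ ≤ 1 → ‖(A * U).trace‖ ≤ c) : traceNorm A ≤ c := by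
  obtain ⟨U, hU, hA⟩ := exists_trace_mul_eq_traceNorm A
  have := h U hU
  rw [hA, Complex.norm_real] at this
  exact (le_abs_self _).trans this

lemma traceNorm_nonneg (A : Matrix n n ℂ) : 0 ≤ traceNorm A :=
  Finset.sum_nonneg fun _ _ => Real.sqrt_nonneg _

lemma traceNorm_add_le (A B : Matrix n n ℂ) :
    traceNorm (A + B) ≤ traceNorm A + traceNorm B := by
  refine traceNorm_le_of_forall fun U hU => ?_
  rw [add_mul, trace_add]
  exact (norm_add_le _ _).trans
    (add_le_add (norm_trace_mul_le_traceNorm A hU) (norm_trace_mul_le_traceNorm B hU))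

lemma traceNorm_smul_le (c : ℂ) (A : Matrix n n ℂ) :
    traceNorm (c • A) ≤ ‖c‖ * traceNorm A := by
  refine traceNorm_le_of_forall fun U hU => ?_
  rw [smul_mul, trace_smul, smul_eq_mul, norm_mul]
  gcongr
  exact norm_trace_mul_le_traceNorm A hU

@[simp]
lemma traceNorm_zero : traceNorm (0 : Matrix n n ℂ) = 0 :=
  le_antisymm (traceNorm_le_of_forall fun U _ => by simp) (traceNorm_nonneg _)

lemma norm_entry_le_traceNorm (A : Matrix n n ℂ) (p q : n) : ‖A p q‖ ≤ traceNorm A := by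
  have hU : ‖clm (Matrix.single q p 1)‖ ≤ 1 := by
    refine ContinuousLinearMap.opNorm_le_bound _ zero_le_one fun y => ?_
    have : clm (Matrix.single q p 1) y = EuclideanSpace.single q (y p) := by
      ext k
      simp [Matrix.single_mulVec_eq, Pi.single_apply]
    rw [this, one_mul, PiLp.norm_single]
    exact PiLp.norm_apply_le y p
  simpa [Matrix.trace_mul_single] using norm_trace_mul_le_traceNorm A hU

lemma traceNorm_pos {A : Matrix n n ℂ} (hA : A ≠ 0) : 0 < traceNorm A := by
  refine (traceNorm_nonneg A).lt_of_ne fun h => hA ?_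
  ext p q
  simpa [← h] using norm_entry_le_traceNorm A p q

lemma traceNorm_le_sum_norm_entry (A : Matrix n n ℂ) : traceNorm A ≤ ∑ p, ∑ q, ‖A p q‖ := by
  refine traceNorm_le_of_forall fun U hU => ?_
  simp only [Matrix.trace, Matrix.diag_apply, Matrix.mul_apply]
  refine norm_sum_le_of_le _ fun p _ => norm_sum_le_of_le _ fun q _ => ?_
  rw [norm_mul]
  refine mul_le_of_le_one_right (norm_nonneg _) ?_
  have h1 := (clm U).le_of_opNorm_le hU (EuclideanSpace.single p 1)
  have h2 := PiLp.norm_apply_le (clm U (EuclideanSpace.single p 1)) q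
  simpa using h2.trans h1

/-- Kraus maps are contractive in the trace norm. -/
lemma traceNorm_kraus_le {κ : Type} [Fintype κ] {B : κ → Matrix n n ℂ}
    (hB : ∑ k, (B k)ᴴ * B k = 1) (X : Matrix n n ℂ) :
    traceNorm (∑ k, B k * X * (B k)ᴴ) ≤ traceNorm X := by
  refine traceNorm_le_of_forall fun U hU => ?_
  have htr : ((∑ k, B k * X * (B k)ᴴ) * U).trace = (X * ∑ k, (B k)ᴴ * U * B k).trace := by
    rw [Finset.sum_mul, Finset.mul_sum, trace_sum, trace_sum]
    refine Finset.sum_congr rfl fun k _ => ?_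
    rw [mul_assoc, mul_assoc, Matrix.trace_mul_comm]
    simp only [mul_assoc]
  rw [htr]
  refine norm_trace_mul_le_traceNorm X ?_
  have hsq (x : EuclideanSpace ℂ n) : √(∑ k, ‖clm (B k) x‖ ^ 2) = ‖x‖ := by
    have h1 : ((∑ k, ‖clm (B k) x‖ ^ 2 : ℝ) : ℂ) = ((‖x‖ ^ 2 : ℝ) : ℂ) := by
      have h2 : inner ℂ x (clm (∑ k, (B k)ᴴ * B k) x) = inner ℂ x x := by simp [hB]
      rw [inner_self_eq_norm_sq_to_K, map_sum, _root_.sum_apply, inner_sum] at h2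
      push_cast
      refine Eq.trans ?_ h2
      refine Finset.sum_congr rfl fun k _ => ?_
      have h3 := inner_toEuclideanCLM_conjTranspose (B k)ᴴ x (clm (B k) x)
      rw [conjTranspose_conjTranspose, inner_self_eq_norm_sq_to_K] at h3
      rw [map_mul, mul_apply_eq_comp]
      exact h3
    rw [Complex.ofReal_injective h1, Real.sqrt_sq (norm_nonneg _)]
  set Z := ∑ k, (B k)ᴴ * U * B k with hZ
  have hbil (x y : EuclideanSpace ℂ n) : ‖inner ℂ y (clm Z x)‖ ≤ ‖y‖ * ‖x‖ := by
    have h1 : inner ℂ y (clm Z x) = ∑ k, inner ℂ (clm (B k) y) (clm U (clm (B k) x)) := by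
      rw [hZ, map_sum, _root_.sum_apply, inner_sum]
      refine Finset.sum_congr rfl fun k _ => ?_
      have h3 := inner_toEuclideanCLM_conjTranspose (B k)ᴴ y (clm U (clm (B k) x))
      rw [conjTranspose_conjTranspose] at h3
      rw [h3, map_mul, map_mul]
      rfl
    rw [h1, ← hsq x, ← hsq y]
    refine le_trans ?_ (Real.sum_mul_le_sqrt_mul_sqrt _ _ _)
    refine norm_sum_le_of_le _ fun k _ => ?_
    refine (norm_inner_le_norm _ _).trans ?_
    gcongr
    simpa using (clm U).le_of_opNorm_le hU (clm (B k) x)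
  refine ContinuousLinearMap.opNorm_le_bound _ zero_le_one fun x => ?_
  rw [one_mul]
  have h := hbil x (clm Z x)
  rw [inner_self_eq_norm_sq_to_K, norm_pow, RCLike.norm_ofReal, abs_norm, sq] at h
  rcases (norm_nonneg (clm Z x)).eq_or_lt with h0 | h0
  · rw [← h0]; positivity
  · exact le_of_mul_le_mul_left h h0

end TraceNorm

section DiamondNorm

open Matrix

variable {d : ℕ} {Φ : Matrix (Fin d × Fin d) (Fin d × Fin d) ℂ}

lemma tensorIdApp_add (Φ Ψ X : Matrix (Fin d × Fin d) (Fin d × Fin d) ℂ) :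
    tensorIdApp (Φ + Ψ) X = tensorIdApp Φ X + tensorIdApp Ψ X := by
  ext p q
  simp [tensorIdApp, add_mul, Finset.sum_add_distrib]

lemma tensorIdApp_smul (c : ℂ) (Φ X : Matrix (Fin d × Fin d) (Fin d × Fin d) ℂ) :
    tensorIdApp (c • Φ) X = c • tensorIdApp Φ X := by
  ext p q
  simp [tensorIdApp, Finset.mul_sum, mul_assoc]

@[simp]
lemma tensorIdApp_zero (X : Matrix (Fin d × Fin d) (Fin d × Fin d) ℂ) :
    tensorIdApp 0 X = 0 := by
  ext p q
  simp [tensorIdApp]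

lemma tensorIdApp_one (X : Matrix (Fin d × Fin d) (Fin d × Fin d) ℂ) :
    tensorIdApp 1 X = X := by
  ext p q
  simp [tensorIdApp, Matrix.one_apply]

lemma tensorIdApp_mul (Φ Ψ X : Matrix (Fin d × Fin d) (Fin d × Fin d) ℂ) :
    tensorIdApp (Φ * Ψ) X = tensorIdApp Φ (tensorIdApp Ψ X) := by
  ext p q
  simp only [tensorIdApp, Matrix.of_apply, Matrix.mul_apply, Finset.sum_mul, Finset.mul_sum]
  rw [Finset.sum_comm]
  simp only [mul_assoc]

lemma bddAbove_range_traceNorm_div (Φ : Matrix (Fin d × Fin d) (Fin d × Fin d) ℂ) :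
    BddAbove (Set.range fun X : {X : Matrix (Fin d × Fin d) (Fin d × Fin d) ℂ // X ≠ 0} =>
      traceNorm (tensorIdApp Φ X.1) / traceNorm X.1) := by
  refine ⟨∑ p : Fin d × Fin d, ∑ q : Fin d × Fin d, ∑ r, ‖Φ (p.1, q.1) r‖, ?_⟩
  rintro _ ⟨⟨X, hX⟩, rfl⟩
  rw [div_le_iff₀ (traceNorm_pos hX)]
  refine (traceNorm_le_sum_norm_entry _).trans ?_
  simp only [Finset.sum_mul]
  gcongr with p _ q _
  refine norm_sum_le_of_le _ fun r _ => ?_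
  rw [norm_mul]
  gcongr
  exact norm_entry_le_traceNorm _ _ _

lemma traceNorm_tensorIdApp_le (Φ X : Matrix (Fin d × Fin d) (Fin d × Fin d) ℂ) :
    traceNorm (tensorIdApp Φ X) ≤ diamondNorm Φ * traceNorm X := by
  by_cases hX : X = 0
  · have : tensorIdApp Φ 0 = 0 := by ext p q; simp [tensorIdApp]
    simp [hX, this]
  · rw [← div_le_iff₀ (traceNorm_pos hX)]
    exact le_ciSup (bddAbove_range_traceNorm_div Φ) ⟨X, hX⟩

lemma diamondNorm_le {c : ℝ} (hc : 0 ≤ c)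
    (h : ∀ X, traceNorm (tensorIdApp Φ X) ≤ c * traceNorm X) : diamondNorm Φ ≤ c :=
  Real.iSup_le (fun X => (div_le_iff₀ (traceNorm_pos X.2)).2 (h X.1)) hc

lemma diamondNorm_nonneg (Φ : Matrix (Fin d × Fin d) (Fin d × Fin d) ℂ) : 0 ≤ diamondNorm Φ :=
  Real.iSup_nonneg fun _ => div_nonneg (traceNorm_nonneg _) (traceNorm_nonneg _)

lemma diamondNorm_add_le (Φ Ψ : Matrix (Fin d × Fin d) (Fin d × Fin d) ℂ) :
    diamondNorm (Φ + Ψ) ≤ diamondNorm Φ + diamondNorm Ψ := by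
  refine diamondNorm_le (add_nonneg (diamondNorm_nonneg _) (diamondNorm_nonneg _)) fun X => ?_
  rw [tensorIdApp_add, add_mul]
  exact (traceNorm_add_le _ _).trans
    (add_le_add (traceNorm_tensorIdApp_le _ _) (traceNorm_tensorIdApp_le _ _))

lemma diamondNorm_smul_le (c : ℂ) (Φ : Matrix (Fin d × Fin d) (Fin d × Fin d) ℂ) :
    diamondNorm (c • Φ) ≤ ‖c‖ * diamondNorm Φ := by
  refine diamondNorm_le (mul_nonneg (norm_nonneg _) (diamondNorm_nonneg _)) fun X => ?_
  rw [tensorIdApp_smul, mul_assoc]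
  exact (traceNorm_smul_le _ _).trans
    (mul_le_mul_of_nonneg_left (traceNorm_tensorIdApp_le _ _) (norm_nonneg _))

lemma diamondNorm_mul_le (Φ Ψ : Matrix (Fin d × Fin d) (Fin d × Fin d) ℂ) :
    diamondNorm (Φ * Ψ) ≤ diamondNorm Φ * diamondNorm Ψ := by
  refine diamondNorm_le (mul_nonneg (diamondNorm_nonneg _) (diamondNorm_nonneg _)) fun X => ?_
  rw [tensorIdApp_mul, mul_assoc]
  exact (traceNorm_tensorIdApp_le _ _).trans
    (mul_le_mul_of_nonneg_left (traceNorm_tensorIdApp_le _ _) (diamondNorm_nonneg _))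

@[simp]
lemma diamondNorm_zero : diamondNorm (0 : Matrix (Fin d × Fin d) (Fin d × Fin d) ℂ) = 0 :=
  le_antisymm (diamondNorm_le le_rfl (by simp)) (diamondNorm_nonneg _)

lemma diamondNorm_sum_le {ι : Type} (s : Finset ι)
    (Φ : ι → Matrix (Fin d × Fin d) (Fin d × Fin d) ℂ) :
    diamondNorm (∑ i ∈ s, Φ i) ≤ ∑ i ∈ s, diamondNorm (Φ i) :=
  Finset.le_sum_of_subadditive diamondNorm diamondNorm_zero.le diamondNorm_add_le s Φ

lemma IsTracePreserving.sum_apply_diag (hΦ : IsTracePreserving Φ) (a b : Fin d) :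
    ∑ i, Φ (i, i) (a, b) = if a = b then 1 else 0 := by
  have h := hΦ (Matrix.single a b 1)
  have h1 (i : Fin d) : app Φ (Matrix.single a b 1) i i = Φ (i, i) (a, b) := by
    simp only [app, Matrix.of_apply]
    rw [Finset.sum_eq_single (a, b)]
    · simp
    · rintro ⟨x, y⟩ _ hxy
      have : ¬(a = x ∧ b = y) := fun h => hxy (by rw [h.1, h.2])
      simp [this]
    · simp
  simp only [Matrix.trace, Matrix.diag_apply, h1] at h
  rw [h]
  change Matrix.trace (Matrix.single a b 1) = _
  split_ifs with hab
  · rw [hab, Matrix.trace_single_eq_same]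
  · exact Matrix.trace_single_eq_of_ne _ _ _ hab

/-- Kraus decomposition of a channel acting on one tensor factor. -/
lemma IsChannel.exists_kraus (hΦ : IsChannel Φ) :
    ∃ B : Fin d × Fin d → Matrix (Fin d × Fin d) (Fin d × Fin d) ℂ,
      (∀ X, tensorIdApp Φ X = ∑ k, B k * X * (B k)ᴴ) ∧ ∑ k, (B k)ᴴ * B k = 1 := by
  obtain ⟨C, hC⟩ : ∃ C : Matrix (Fin d × Fin d) (Fin d × Fin d) ℂ, choi Φ = Cᴴ * C := by
    open scoped MatrixOrder Matrix.Norms.L2Operator in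
    exact CStarAlgebra.nonneg_iff_eq_star_mul_self.mp hΦ.1.nonneg
  have hC' (i j : Fin d) (r : Fin d × Fin d) :
      Φ (i, j) r = ∑ k, star (C k (r.1, i)) * C k (r.2, j) := by
    have := congrFun (congrFun hC (r.1, i)) (r.2, j)
    simpa [choi, Matrix.mul_apply] using this
  refine ⟨fun k => Matrix.of fun p q => if p.2 = q.2 then star (C k (q.1, p.1)) else 0,
    fun X => ?_, ?_⟩
  · ext ⟨i, s⟩ ⟨j, t⟩
    simp only [tensorIdApp, Matrix.of_apply, hC', Finset.sum_mul, Matrix.sum_apply]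
    rw [Finset.sum_comm]
    refine Finset.sum_congr rfl fun k _ => ?_
    simp only [Matrix.mul_apply, Fintype.sum_prod_type, Matrix.of_apply, ite_mul, zero_mul,
      Finset.sum_ite_eq, Finset.mem_univ, if_true, Matrix.conjTranspose_apply, apply_ite star,
      star_star, star_zero, mul_ite, mul_zero, Finset.sum_mul]
    rw [Finset.sum_comm]
    exact Finset.sum_congr rfl fun _ _ => Finset.sum_congr rfl fun _ _ => mul_right_comm _ _ _
  · ext ⟨a, t⟩ ⟨b, u⟩
    have h := hΦ.2.sum_apply_diag b a
    simp only [hC'] at h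
    rw [Finset.sum_comm] at h
    rw [Matrix.sum_apply]
    by_cases htu : t = u
    · subst htu
      refine (Finset.sum_congr rfl fun k _ => ?_).trans (h.trans ?_)
      · simp [Matrix.mul_apply, Fintype.sum_prod_type, apply_ite star, mul_comm]
      · simp [Matrix.one_apply, eq_comm]
    · rw [Matrix.one_apply_ne (by simp [htu])]
      refine Finset.sum_eq_zero fun k _ => ?_
      simp [Matrix.mul_apply, Fintype.sum_prod_type, apply_ite star, Ne.symm htu]

lemma IsChannel.diamondNorm_le_one (hΦ : IsChannel Φ) : diamondNorm Φ ≤ 1 := by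
  obtain ⟨B, hB, hB1⟩ := hΦ.exists_kraus
  refine diamondNorm_le zero_le_one fun X => ?_
  rw [hB, one_mul]
  exact traceNorm_kraus_le hB1 X

lemma isUnit_of_diamondNorm_one_sub_lt_one (h : diamondNorm (1 - Φ) < 1) : IsUnit Φ := by
  rw [← Matrix.mulVec_injective_iff_isUnit]
  refine (injective_iff_map_eq_zero (Matrix.mulVecLin Φ)).2 fun x hx => ?_
  set X : Matrix (Fin d × Fin d) (Fin d × Fin d) ℂ := Matrix.of fun p q => x (p.1, q.1) with hXdef
  have hΦX : tensorIdApp Φ X = 0 := by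
    ext p q
    exact congrFun hx (p.1, q.1)
  have hX : tensorIdApp (1 - Φ) X = X := by
    rw [sub_eq_add_neg, ← neg_one_smul ℂ Φ, tensorIdApp_add, tensorIdApp_smul, hΦX,
      tensorIdApp_one, smul_zero, add_zero]
  have hX0 : X = 0 := by
    by_contra hne
    have := traceNorm_tensorIdApp_le (1 - Φ) X
    rw [hX] at this
    nlinarith [traceNorm_pos hne]
  ext ⟨i, j⟩
  exact congrFun (congrFun hX0 (i, i)) (j, j)

end DiamondNorm

end RB

open RB in
/-- Stability of representations under the diamond norm: an implementation map can be
close to two representations at once only if they share a common subrepresentation of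
dimension at least `d²`. -/
theorem stability_of_representations
    {G : Type} [Group G] [Fintype G] (d : ℕ)
    (φ : G → Matrix (Fin d × Fin d) (Fin d × Fin d) ℂ)
    (hφ : ∀ g : G, IsChannel (φ g))
    (δ ε ε' K : ℝ)
    (hδ : (Fintype.card G : ℝ)⁻¹ * ∑ g : G, diamondNorm (1 - φ g * φ g⁻¹) ≤ δ)
    (nV nV' : ℕ)
    (ω : G →* Matrix (Fin nV) (Fin nV) ℂ)
    (ω' : G →* Matrix (Fin nV') (Fin nV') ℂ)
    (L : Matrix (Fin nV) (Fin d × Fin d) ℂ) (R : Matrix (Fin d × Fin d) (Fin nV) ℂ)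
    (L' : Matrix (Fin nV') (Fin d × Fin d) ℂ) (R' : Matrix (Fin d × Fin d) (Fin nV') ℂ)
    (hε : (Fintype.card G : ℝ)⁻¹ * ∑ g : G, diamondNorm (φ g - R * ω g * L) ≤ ε)
    (hε' : (Fintype.card G : ℝ)⁻¹ * ∑ g : G, diamondNorm (φ g - R' * ω' g * L') ≤ ε')
    (hK : ∀ g : G, diamondNorm (R * ω g * L) ≤ K ∧ diamondNorm (R' * ω' g * L') ≤ K)
    (hcond : K * (ε + ε') + 3 * δ + 2 * ε + ε ^ 2 < 1) :
    ∃ T : Matrix (Fin nV) (Fin nV') ℂ,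
      d ^ 2 ≤ T.rank ∧ ∀ g : G, ω g * T = T * ω' g := by
  set c : ℂ := (Fintype.card G : ℂ)⁻¹ with hc
  have hcard : (Fintype.card G : ℂ) ≠ 0 := Nat.cast_ne_zero.2 Fintype.card_ne_zero
  have hcn : ‖c‖ = (Fintype.card G : ℝ)⁻¹ := by simp [hc]
  have hci : (0 : ℝ) ≤ (Fintype.card G : ℝ)⁻¹ := by positivity
  set T : Matrix (Fin nV) (Fin nV') ℂ := c • ∑ g : G, ω g * (L * R') * ω' g⁻¹ with hT
  refine ⟨T, ?_, fun h => ?_⟩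
  · set Δ : G → Matrix (Fin d × Fin d) (Fin d × Fin d) ℂ := fun g =>
      1 - (R * ω g * L) * (R' * ω' g⁻¹ * L') with hΔ
    have hsum : 1 - R * T * L' = c • ∑ g : G, Δ g := by
      simp only [hΔ, hT, Finset.sum_sub_distrib, smul_sub, Finset.sum_const, Finset.card_univ,
        Matrix.mul_smul, Matrix.smul_mul, Matrix.mul_sum, Matrix.sum_mul, Matrix.mul_assoc]
      rw [← Nat.cast_smul_eq_nsmul ℂ, smul_smul, hc, inv_mul_cancel₀ hcard, one_smul]
    have hterm (g : G) : diamondNorm (Δ g) ≤ diamondNorm (1 - φ g * φ g⁻¹) +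
        diamondNorm (φ g - R * ω g * L) +
        K * diamondNorm (φ g⁻¹ - R' * ω' g⁻¹ * L') := by
      have hdec : Δ g = (1 - φ g * φ g⁻¹) + (φ g - R * ω g * L) * φ g⁻¹ +
          (R * ω g * L) * (φ g⁻¹ - R' * ω' g⁻¹ * L') := by
        simp only [hΔ, sub_mul, mul_sub]
        abel
      rw [hdec]
      refine (diamondNorm_add_le _ _).trans (add_le_add ((diamondNorm_add_le _ _).trans ?_) ?_)
      · gcongr
        exact (diamondNorm_mul_le _ _).trans
          (mul_le_of_le_one_right (diamondNorm_nonneg _) (hφ g⁻¹).diamondNorm_le_one)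
      · exact (diamondNorm_mul_le _ _).trans
          (mul_le_mul_of_nonneg_right (hK g).1 (diamondNorm_nonneg _))
    have hinv : ∑ g : G, diamondNorm (φ g⁻¹ - R' * ω' g⁻¹ * L') =
        ∑ g : G, diamondNorm (φ g - R' * ω' g * L') :=
      Equiv.sum_comp (Equiv.inv G) fun g => diamondNorm (φ g - R' * ω' g * L')
    have hK0 : 0 ≤ K := (diamondNorm_nonneg _).trans (hK 1).1
    have hnonneg (Φ : G → Matrix (Fin d × Fin d) (Fin d × Fin d) ℂ) :
        0 ≤ (Fintype.card G : ℝ)⁻¹ * ∑ g : G, diamondNorm (Φ g) :=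
      mul_nonneg hci (Finset.sum_nonneg fun _ _ => diamondNorm_nonneg _)
    have hδ0 : 0 ≤ δ := (hnonneg _).trans hδ
    have hε0 : 0 ≤ ε := (hnonneg _).trans hε
    have hbound : diamondNorm (1 - R * T * L') ≤ δ + ε + K * ε' := by
      rw [hsum]
      refine (diamondNorm_smul_le _ _).trans ?_
      rw [hcn]
      refine (mul_le_mul_of_nonneg_left ((diamondNorm_sum_le _ _).trans
        (Finset.sum_le_sum fun g _ => hterm g)) hci).trans ?_
      rw [Finset.sum_add_distrib, Finset.sum_add_distrib, ← Finset.mul_sum, hinv, mul_add,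
        mul_add, mul_left_comm]
      gcongr
    have hunit : IsUnit (R * T * L') :=
      isUnit_of_diamondNorm_one_sub_lt_one (hbound.trans_lt (by nlinarith))
    calc d ^ 2 = (R * T * L').rank := by
          rw [Matrix.rank_of_isUnit _ hunit, Fintype.card_prod, Fintype.card_fin, sq]
      _ ≤ (R * T).rank := Matrix.rank_mul_le_left _ _
      _ ≤ T.rank := Matrix.rank_mul_le_right _ _
  · rw [hT, Matrix.mul_smul, Matrix.smul_mul, Matrix.mul_sum, Matrix.sum_mul]
    congr 1
    refine Fintype.sum_equiv (Equiv.mulLeft h) _ _ fun g => ?_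
    simp only [Equiv.coe_mulLeft, mul_inv_rev, map_mul, Matrix.mul_assoc]
    rw [← map_mul ω' h⁻¹ h, inv_mul_cancel, map_one, Matrix.mul_one]
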